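/- Consider the model with one nifBm: observations X̃_k^{jh} := a X_{k·jh}^{jh,H} for j ∈ {1,2}, with 0 < H < 1 and a² > 0. Define Ĥ_N := (1/(2 log 2)) log₊(ξ²_N / ξ¹_N), Â_N := 2 h^{2Ĥ_N} / ((2Ĥ_N + 1)(Ĥ_N + 1)), and â²_N := ξ¹_N / (Â_N (2^{2Ĥ_N} − 1)). Then the estimator θ̂_N = (Ĥ_N, â²_N) converges almost surely to θ = (H, a²) as N → ∞. -/

import Mathlib

open MeasureTheory ProbabilityTheory Filter Real Matrix Topology

noncomputable section

variable {Ω : Type*} [MeasurableSpace Ω]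

/-- A (centered) fractional Brownian motion with Hurst index `H` on the probability space
`(Ω, P)`: a jointly measurable process with a.s. continuous sample paths, whose
finite-dimensional distributions are centered Gaussian (equivalently, every finite linear
combination of values of the process is a centered real Gaussian random variable), with
covariance `E[W_s W_t] = (s^{2H} + t^{2H} - |s-t|^{2H})/2` for `s, t ≥ 0`. -/
structure IsFBM (P : Measure Ω) (H : ℝ) (W : ℝ → Ω → ℝ) : Prop where
  jointMeasurable : Measurable (Function.uncurry W)
  gaussian_fdd : ∀ (n : ℕ) (t : Fin n → ℝ), (∀ i, 0 ≤ t i) → ∀ c : Fin n → ℝ,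
    ∃ v : NNReal, P.map (fun ω => ∑ i, c i * W (t i) ω) = gaussianReal 0 v
  cov : ∀ s t : ℝ, 0 ≤ s → 0 ≤ t →
    ∫ ω, W s ω * W t ω ∂P = (s ^ (2*H) + t ^ (2*H) - |s - t| ^ (2*H)) / 2
  cont : ∀ᵐ ω ∂P, Continuous fun t => W t ω

/-- The normalized integrated fractional Brownian motion (nifBm) with window `h`:
`X_t^{h,H} = (1/h) ∫_t^{t+h} W_u du`. -/
def nifBm (W : ℝ → Ω → ℝ) (h t : ℝ) (ω : Ω) : ℝ := (1/h) * ∫ u in t..(t+h), W u ω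

/-- The function `γ(H, n)`. -/
def gam (H : ℝ) (n : ℤ) : ℝ :=
  (|(n:ℝ) - 2| ^ (2*H+2) - 4 * |(n:ℝ) - 1| ^ (2*H+2) + 6 * |(n:ℝ)| ^ (2*H+2)
    - 4 * |(n:ℝ) + 1| ^ (2*H+2) + |(n:ℝ) + 2| ^ (2*H+2)) / (4 * (2*H+1) * (H+1))

/-- `log₊ x = log x` for `x > 0` and `0` otherwise. -/
def logpos (x : ℝ) : ℝ := if 0 < x then Real.log x else 0

/-- The statistic `ξ^j_N` in the one-nifBm model:
`ξ^j_N = (1/N) ∑_{k=0}^{N-1} (a X_{(k+1)jh}^{jh,H} - a X_{k·jh}^{jh,H})²`. -/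
def xiOne (W : ℝ → Ω → ℝ) (a h : ℝ) (j N : ℕ) (ω : Ω) : ℝ :=
  (1/(N:ℝ)) * ∑ k ∈ Finset.range N,
    (a * nifBm W ((j:ℝ)*h) (((k:ℝ)+1)*((j:ℝ)*h)) ω
      - a * nifBm W ((j:ℝ)*h) ((k:ℝ)*((j:ℝ)*h)) ω)^2

/-- `Ĥ_N` in the one-nifBm model. -/
def HestOne (W : ℝ → Ω → ℝ) (a h : ℝ) (N : ℕ) (ω : Ω) : ℝ :=
  (1/(2*Real.log 2)) * logpos (xiOne W a h 2 N ω / xiOne W a h 1 N ω)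

/-- `Â_N` in the one-nifBm model. -/
def AestOne (W : ℝ → Ω → ℝ) (a h : ℝ) (N : ℕ) (ω : Ω) : ℝ :=
  2 * h ^ (2 * HestOne W a h N ω) /
    ((2 * HestOne W a h N ω + 1) * (HestOne W a h N ω + 1))

/-- `â²_N` in the one-nifBm model. -/
def a2estOne (W : ℝ → Ω → ℝ) (a h : ℝ) (N : ℕ) (ω : Ω) : ℝ :=
  xiOne W a h 1 N ω / (AestOne W a h N ω * ((2:ℝ) ^ (2 * HestOne W a h N ω) - 1))

lemma fourth_moment_gaussianReal (v : NNReal) :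
    ∫ x, x ^ 4 ∂(gaussianReal 0 v) = 3 * (v : ℝ) ^ 2 := by
  have h1 : iteratedDeriv 4 (mgf (fun x : ℝ => x) (gaussianReal 0 v)) 0
      = ∫ x, x ^ 4 ∂(gaussianReal 0 v) := by
    rw [iteratedDeriv_mgf_zero] <;> simp
  have key : ∀ (p q : Polynomial ℝ), q = p.derivative + Polynomial.C (v : ℝ) * Polynomial.X * p →
      deriv (fun t : ℝ => p.eval t * rexp (v * t ^ 2 / 2))
        = fun t => q.eval t * rexp (v * t ^ 2 / 2) := by
    rintro p q rfl
    ext t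
    have h2 : HasDerivAt (fun t : ℝ => rexp (v * t ^ 2 / 2))
        (rexp (v * t ^ 2 / 2) * (v * (2 * t) / 2)) t := by
      have := (((hasDerivAt_pow 2 t).const_mul (v : ℝ)).div_const 2).exp
      simpa using this
    have h3 := (p.hasDerivAt t).mul h2
    refine h3.deriv.trans ?_
    simp
    ring
  have h0 : mgf (fun x : ℝ => x) (gaussianReal 0 v)
      = fun t => (1 : Polynomial ℝ).eval t * rexp (v * t ^ 2 / 2) := by
    rw [mgf_fun_id_gaussianReal]; ext t; simp
  rw [← h1, h0]
  simp only [iteratedDeriv_succ', iteratedDeriv_zero]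
  rw [key _ _ rfl, key _ _ rfl, key _ _ rfl, key _ _ rfl]
  simp
  ring

/-- A real random variable with centered Gaussian law has `E X ^ 4 = 3 (E X ^ 2) ^ 2`. -/
lemma integral_pow_four_of_map_eq_gaussianReal {P : Measure Ω} {X : Ω → ℝ} (hX : Measurable X)
    {v : NNReal} (h : P.map X = gaussianReal 0 v) :
    ∫ ω, X ω ^ 4 ∂P = 3 * (∫ ω, X ω ^ 2 ∂P) ^ 2 := by
  have h4 : ∫ ω, X ω ^ 4 ∂P = ∫ x, x ^ 4 ∂(P.map X) :=
    (integral_map hX.aemeasurable (continuous_pow 4).aestronglyMeasurable).symm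
  have h2 : ∫ ω, X ω ^ 2 ∂P = ∫ x, x ^ 2 ∂(P.map X) :=
    (integral_map hX.aemeasurable (continuous_pow 2).aestronglyMeasurable).symm
  rw [h4, h2, h, fourth_moment_gaussianReal]
  have := variance_fun_id_gaussianReal (μ := 0) (v := v)
  rw [variance_eq_integral measurable_id'.aemeasurable] at this
  simp only [integral_id_gaussianReal, sub_zero] at this
  rw [this]

lemma memLp_of_map_eq_gaussianReal {P : Measure Ω} {X : Ω → ℝ} (hX : Measurable X)
    {v : NNReal} (h : P.map X = gaussianReal 0 v) (p : ENNReal) (hp : p ≠ ⊤) :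
    MemLp X p P := by
  have := memLp_id_gaussianReal' (μ := 0) (v := v) p hp
  rw [← h] at this
  exact (memLp_map_measure_iff aestronglyMeasurable_id hX.aemeasurable).1 this

/-- Random variables all of whose linear combinations are centered Gaussian. -/
structure IsCenteredGaussianFamily {ι : Type*} [Fintype ι] (P : Measure Ω) (X : ι → Ω → ℝ) :
    Prop where
  measurable : ∀ i, Measurable (X i)
  map_sum : ∀ c : ι → ℝ, ∃ v : NNReal, P.map (fun ω => ∑ i, c i * X i ω) = gaussianReal 0 v

namespace IsCenteredGaussianFamily

variable {ι : Type*} [Fintype ι] {P : Measure Ω} {X : ι → Ω → ℝ}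

lemma memLp (hX : IsCenteredGaussianFamily P X) (i : ι) (p : ENNReal) (hp : p ≠ ⊤) :
    MemLp (X i) p P := by
  classical
  obtain ⟨v, hv⟩ := hX.map_sum (Pi.single i 1)
  simp only [Pi.single_apply, ite_mul, one_mul, zero_mul, Finset.sum_ite_eq', Finset.mem_univ,
    if_true] at hv
  exact memLp_of_map_eq_gaussianReal (hX.measurable i) hv p hp

lemma integrable_mul (hX : IsCenteredGaussianFamily P X) (i j : ι) :
    Integrable (fun ω => X i ω * X j ω) P :=
  (hX.memLp i 2 (by simp)).integrable_mul (hX.memLp j 2 (by simp))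

lemma memLp_mul (hX : IsCenteredGaussianFamily P X) (i j : ι) :
    MemLp (fun ω => X i ω * X j ω) 2 P :=
  (hX.memLp j 4 (by simp)).mul (hX.memLp i 4 (by simp)) (hpqr := ⟨by
    rw [← two_mul, show (4 : ENNReal) = 2 * 2 by norm_num, ENNReal.mul_inv (by simp) (by simp),
      ← mul_assoc, ENNReal.mul_inv_cancel (by simp) (by simp), one_mul]⟩)

lemma integrable_mul_mul_mul (hX : IsCenteredGaussianFamily P X) (i j k l : ι) :
    Integrable (fun ω => X i ω * X j ω * X k ω * X l ω) P := by
  have := (hX.memLp_mul i j).integrable_mul (hX.memLp_mul k l)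
  simpa only [Pi.mul_def, mul_assoc] using this

lemma integral_pow_four (hX : IsCenteredGaussianFamily P X) (c : ι → ℝ) :
    ∫ ω, (∑ i, c i * X i ω) ^ 4 ∂P = 3 * (∫ ω, (∑ i, c i * X i ω) ^ 2 ∂P) ^ 2 := by
  obtain ⟨v, hv⟩ := hX.map_sum c
  have := hX.measurable
  exact integral_pow_four_of_map_eq_gaussianReal (by fun_prop) hv

lemma integral_sum_sq (hX : IsCenteredGaussianFamily P X) (c : ι → ℝ) :
    ∫ ω, (∑ i, c i * X i ω) ^ 2 ∂P = ∑ i, ∑ j, c i * c j * ∫ ω, X i ω * X j ω ∂P := by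
  have hI : ∀ i j, Integrable (fun ω => c i * X i ω * (c j * X j ω)) P := fun i j =>
    ((hX.integrable_mul i j).const_mul (c i * c j)).congr (ae_of_all _ fun ω => by
      simp only; ring)
  simp_rw [sq, Finset.sum_mul_sum]
  rw [integral_finsetSum _ fun i _ => integrable_finsetSum _ fun j _ => hI i j]
  refine Finset.sum_congr rfl fun i _ => ?_
  rw [integral_finsetSum _ fun j _ => hI i j]
  refine Finset.sum_congr rfl fun j _ => ?_
  rw [← integral_const_mul]
  congr 1 with ω
  ring

lemma integrable_pow_four (hX : IsCenteredGaussianFamily P X) (c : ι → ℝ) :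
    Integrable (fun ω => (∑ i, c i * X i ω) ^ 4) P := by
  obtain ⟨v, hv⟩ := hX.map_sum c
  have := hX.measurable
  have h := (memLp_of_map_eq_gaussianReal (by fun_prop) hv 4 (by simp)).integrable_norm_pow
    (by norm_num)
  refine h.congr (ae_of_all _ fun ω => ?_)
  simp [Even.pow_abs (⟨2, rfl⟩ : Even 4)]

end IsCenteredGaussianFamily

/-- Wick's formula for the fourth mixed moment of a centered Gaussian family. -/
lemma IsCenteredGaussianFamily.integral_mul_mul_mul {P : Measure Ω} {X : Fin 4 → Ω → ℝ}
    (hX : IsCenteredGaussianFamily P X) :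
    ∫ ω, X 0 ω * X 1 ω * X 2 ω * X 3 ω ∂P
      = (∫ ω, X 0 ω * X 1 ω ∂P) * (∫ ω, X 2 ω * X 3 ω ∂P)
        + (∫ ω, X 0 ω * X 2 ω ∂P) * (∫ ω, X 1 ω * X 3 ω ∂P)
        + (∫ ω, X 0 ω * X 3 ω ∂P) * (∫ ω, X 1 ω * X 2 ω ∂P) := by
  have e : ∀ ω, X 0 ω * X 1 ω * X 2 ω * X 3 ω = (1 / 192) *
      ((∑ i, (![1, 1, 1, 1] : Fin 4 → ℝ) i * X i ω) ^ 4
      - (∑ i, (![1, -1, 1, 1] : Fin 4 → ℝ) i * X i ω) ^ 4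
      - (∑ i, (![1, 1, -1, 1] : Fin 4 → ℝ) i * X i ω) ^ 4
      - (∑ i, (![1, 1, 1, -1] : Fin 4 → ℝ) i * X i ω) ^ 4
      + (∑ i, (![1, -1, -1, 1] : Fin 4 → ℝ) i * X i ω) ^ 4
      + (∑ i, (![1, -1, 1, -1] : Fin 4 → ℝ) i * X i ω) ^ 4
      + (∑ i, (![1, 1, -1, -1] : Fin 4 → ℝ) i * X i ω) ^ 4
      - (∑ i, (![1, -1, -1, -1] : Fin 4 → ℝ) i * X i ω) ^ 4) := by
    intro ω
    simp [Fin.sum_univ_four]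
    ring
  have I := hX.integrable_pow_four
  have s (i j : Fin 4) : ∫ ω, X i ω * X j ω ∂P = ∫ ω, X j ω * X i ω ∂P := by
    simp only [mul_comm]
  simp_rw [e]
  rw [integral_const_mul, integral_sub, integral_add, integral_add, integral_add, integral_sub,
    integral_sub, integral_sub]
  · simp only [hX.integral_pow_four, hX.integral_sum_sq]
    simp only [Fin.sum_univ_four, s 1 0, s 2 0, s 3 0, s 2 1, s 3 1, s 3 2]
    simp
    ring
  all_goals fun_prop

/-- The correlation at lag `x` of unit increments of fractional Brownian motion. -/
def fgnCov (H x : ℝ) : ℝ := (|x + 1| ^ (2*H) + |x - 1| ^ (2*H) - 2 * |x| ^ (2*H)) / 2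

lemma fgnCov_neg (H x : ℝ) : fgnCov H (-x) = fgnCov H x := by
  unfold fgnCov
  rw [show -x + 1 = -(x - 1) by ring, show -x - 1 = -(x + 1) by ring, abs_neg, abs_neg, abs_neg]
  ring

lemma continuous_fgnCov {H : ℝ} (hH : 0 < H) : Continuous (fgnCov H) := by
  have h (x : ℝ) : 0 ≤ 2 * H := by positivity
  unfold fgnCov
  have h1 : Continuous fun x : ℝ => |x + 1| ^ (2*H) :=
    (by fun_prop : Continuous fun x : ℝ => |x + 1|).rpow_const fun x => Or.inr (h x)
  have h2 : Continuous fun x : ℝ => |x - 1| ^ (2*H) :=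
    (by fun_prop : Continuous fun x : ℝ => |x - 1|).rpow_const fun x => Or.inr (h x)
  have h3 : Continuous fun x : ℝ => |x| ^ (2*H) :=
    (by fun_prop : Continuous fun x : ℝ => |x|).rpow_const fun x => Or.inr (h x)
  fun_prop

lemma abs_fgnCov_le_of_two_le {H : ℝ} (hH : H ∈ Set.Ioo (0:ℝ) 1) {x : ℝ} (hx : 2 ≤ x) :
    |fgnCov H x| ≤ (x - 1) ^ (2*H - 2) := by
  obtain ⟨h0, h1⟩ := hH
  have hd (p y : ℝ) (hy : 0 < y) : HasDerivAt (fun y : ℝ => y ^ p) (p * y ^ (p - 1)) y :=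
    Real.hasDerivAt_rpow_const (Or.inl hy.ne')
  have hd' (p y : ℝ) (hy : 0 < y) :
      HasDerivAt (fun y : ℝ => (y + 1) ^ p) (p * (y + 1) ^ (p - 1)) y :=
    HasDerivAt.comp_add_const y 1 (hd p (y + 1) (by linarith))
  have hg (y : ℝ) (hy : 0 < y) : HasDerivAt (fun y : ℝ => (y + 1) ^ (2*H) - y ^ (2*H))
      ((2*H) * (y + 1) ^ (2*H - 1) - (2*H) * y ^ (2*H - 1)) y := (hd' _ y hy).sub (hd _ y hy)
  obtain ⟨ξ, ⟨hξ1, hξ2⟩, hξ⟩ := exists_hasDerivAt_eq_slope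
    (fun y : ℝ => (y + 1) ^ (2*H) - y ^ (2*H)) _ (by linarith : x - 1 < x)
    (fun y hy => (hg y (by linarith [hy.1])).continuousAt.continuousWithinAt)
    (fun y hy => hg y (by linarith [hy.1]))
  obtain ⟨η, ⟨hη1, hη2⟩, hη⟩ := exists_hasDerivAt_eq_slope
    (fun y : ℝ => y ^ (2*H - 1)) _ (by linarith : ξ < ξ + 1)
    (fun y hy => (hd (2*H - 1) y (by linarith [hy.1])).continuousAt.continuousWithinAt)
    (fun y hy => hd (2*H - 1) y (by linarith [hy.1]))
  have e : fgnCov H x = H * (2*H - 1) * η ^ (2*H - 2) := by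
    unfold fgnCov
    rw [abs_of_pos (by linarith), abs_of_pos (by linarith), abs_of_pos (by linarith)]
    simp only [sub_add_cancel, sub_sub_cancel, div_one, add_sub_cancel_left] at hξ hη
    rw [show 2*H - 2 = 2*H - 1 - 1 by ring]
    linear_combination (-1/2) * hξ - H * hη
  have hη0 : 0 < η := by linarith
  rw [e, abs_mul, abs_of_pos (Real.rpow_pos_of_pos hη0 _)]
  have hc : |H * (2*H - 1)| ≤ 1 := by
    rw [abs_le]; constructor <;> nlinarith
  calc |H * (2*H - 1)| * η ^ (2*H - 2) ≤ 1 * η ^ (2*H - 2) := by gcongr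
    _ = η ^ (2*H - 2) := one_mul _
    _ ≤ (x - 1) ^ (2*H - 2) :=
      Real.rpow_le_rpow_of_nonpos (by linarith) (by linarith) (by linarith)

lemma abs_fgnCov_le {H : ℝ} (hH : H ∈ Set.Ioo (0:ℝ) 1) {x : ℝ} {n : ℕ}
    (h1 : (n:ℝ) - 1 ≤ |x|) (h2 : |x| ≤ n + 1) :
    |fgnCov H x| ≤ 288 * ((n:ℝ) + 1) ^ (2*H - 2) := by
  wlog hx : 0 ≤ x generalizing x
  · have := this (x := -x) (by rwa [abs_neg]) (by rwa [abs_neg]) (by linarith)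
    rwa [fgnCov_neg] at this
  have h0 := hH.1
  have h1' := hH.2
  rw [abs_of_nonneg hx] at h1 h2
  rcases le_or_gt 3 n with hn | hn
  · have hn' : (3:ℝ) ≤ n := by exact_mod_cast hn
    calc |fgnCov H x| ≤ (x - 1) ^ (2*H - 2) := abs_fgnCov_le_of_two_le hH (by linarith)
      _ ≤ (((n:ℝ) + 1) / 4) ^ (2*H - 2) :=
        Real.rpow_le_rpow_of_nonpos (by linarith) (by linarith) (by linarith)
      _ = (4:ℝ) ^ (2 - 2*H) * ((n:ℝ) + 1) ^ (2*H - 2) := by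
        rw [Real.div_rpow (by linarith) (by norm_num), div_eq_mul_inv,
          ← Real.rpow_neg (by norm_num), neg_sub, mul_comm]
      _ ≤ 288 * ((n:ℝ) + 1) ^ (2*H - 2) := by
        gcongr
        calc (4:ℝ) ^ (2 - 2*H) ≤ (4:ℝ) ^ (2:ℝ) :=
              Real.rpow_le_rpow_of_exponent_le (by norm_num) (by linarith)
          _ ≤ 288 := by norm_num
  · have hn' : (n:ℝ) ≤ 2 := by exact_mod_cast Nat.lt_succ_iff.1 hn
    have hb (y : ℝ) (hy : |y| ≤ 4) : |y| ^ (2*H) ≤ 16 := by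
      calc |y| ^ (2*H) ≤ (4:ℝ) ^ (2*H) :=
            Real.rpow_le_rpow (abs_nonneg _) hy (by linarith)
        _ ≤ (4:ℝ) ^ (2:ℝ) := Real.rpow_le_rpow_of_exponent_le (by norm_num) (by linarith)
        _ = 16 := by norm_num
    have hb' (y : ℝ) : 0 ≤ |y| ^ (2*H) := Real.rpow_nonneg (abs_nonneg _) _
    have b1 := hb (x + 1) (by rw [abs_le]; constructor <;> linarith)
    have b2 := hb (x - 1) (by rw [abs_le]; constructor <;> linarith)
    have b3 := hb x (by rw [abs_le]; constructor <;> linarith)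
    have c1 := hb' (x + 1)
    have c2 := hb' (x - 1)
    have c3 := hb' x
    have hr : |fgnCov H x| ≤ 32 := by
      unfold fgnCov
      rw [abs_le]; constructor <;> linarith
    have hp : (1:ℝ) / 9 ≤ ((n:ℝ) + 1) ^ (2*H - 2) := by
      calc (1:ℝ) / 9 = (3:ℝ) ^ (-2:ℝ) := by
            rw [Real.rpow_neg (by norm_num)]; norm_num
        _ ≤ (3:ℝ) ^ (2*H - 2) :=
          Real.rpow_le_rpow_of_exponent_le (by norm_num) (by linarith)
        _ ≤ ((n:ℝ) + 1) ^ (2*H - 2) :=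
          Real.rpow_le_rpow_of_nonpos (by positivity) (by linarith) (by linarith)
    linarith

lemma sum_range_rpow_neg_le {ε : ℝ} (h0 : 0 ≤ ε) (h1 : ε ≤ 1 / 2) (N : ℕ) :
    ∑ n ∈ Finset.range N, ((n:ℝ) + 1) ^ (-ε) ≤ 2 * (N:ℝ) ^ (1 - ε) := by
  induction N with
  | zero => simp [Real.zero_rpow (by linarith : 1 - ε ≠ 0)]
  | succ N ih =>
    rw [Finset.sum_range_succ]
    push_cast
    set M : ℝ := (N:ℝ) + 1 with hM
    have hM1 : 1 ≤ M := by simp [hM]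
    have hM0 : 0 < M := by linarith
    have hb : (1 + -(1 / M)) ^ (1 - ε) ≤ 1 + (1 - ε) * -(1 / M) :=
      rpow_one_add_le_one_add_mul_self
        (by rw [neg_le_neg_iff, div_le_one hM0]; exact hM1) (by linarith) (by linarith)
    have hN : (N:ℝ) = M * (1 + -(1 / M)) := by
      field_simp; simp [hM]
    have hN' : (N:ℝ) ^ (1 - ε) = M ^ (1 - ε) * (1 + -(1 / M)) ^ (1 - ε) := by
      rw [hN, Real.mul_rpow hM0.le]
      rw [← sub_eq_add_neg, sub_nonneg, div_le_one hM0]; exact hM1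
    have hMe : M ^ (-ε) = M ^ (1 - ε) * (1 / M) := by
      rw [show -ε = (1 - ε) - 1 by ring, Real.rpow_sub_one hM0.ne']; ring
    have hMp : 0 < M ^ (1 - ε) := Real.rpow_pos_of_pos hM0 _
    have hi : 0 < 1 / M := by positivity
    have : (1 + -(1 / M)) ^ (1 - ε) ≤ 1 - (1 / 2) * (1 / M) := by nlinarith
    rw [hN'] at ih
    rw [hMe]
    nlinarith [mul_le_mul_of_nonneg_left this hMp.le]

lemma sum_range_natAbs_sub_le {f : ℕ → ℝ} (hf : ∀ n, 0 ≤ f n) {k N : ℕ} (hk : k < N) :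
    ∑ l ∈ Finset.range N, f ((k:ℤ) - l).natAbs ≤ 2 * ∑ n ∈ Finset.range N, f n := by
  obtain ⟨m, rfl⟩ : ∃ m, N = (k + 1) + m := ⟨N - (k + 1), by omega⟩
  have h1 : ∑ l ∈ Finset.range (k + 1), f ((k:ℤ) - l).natAbs = ∑ n ∈ Finset.range (k + 1), f n := by
    rw [← Finset.sum_range_reflect f]
    refine Finset.sum_congr rfl fun l hl => ?_
    rw [Finset.mem_range] at hl
    congr 1
    omega
  have h2 : ∑ i ∈ Finset.range m, f ((k:ℤ) - ((k + 1 + i : ℕ) : ℤ)).natAbs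
      = ∑ i ∈ Finset.range m, f (i + 1) := by
    refine Finset.sum_congr rfl fun i _ => ?_
    congr 1
    omega
  have h3 : ∑ i ∈ Finset.range m, f (i + 1) ≤ ∑ n ∈ Finset.range (k + 1 + m), f n := by
    have : ∑ i ∈ Finset.range m, f (i + 1) ≤ ∑ n ∈ Finset.range (m + 1), f n := by
      rw [Finset.sum_range_succ']; linarith [hf 0]
    refine this.trans (Finset.sum_le_sum_of_subset_of_nonneg ?_ fun _ _ _ => hf _)
    exact Finset.range_subset_range.2 (by omega)
  have h4 : ∑ n ∈ Finset.range (k + 1), f n ≤ ∑ n ∈ Finset.range (k + 1 + m), f n :=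
    Finset.sum_le_sum_of_subset_of_nonneg (Finset.range_subset_range.2 (by omega))
      fun _ _ _ => hf _
  rw [Finset.sum_range_add, h1, h2]
  linarith

/-- The increment of `W` from `δ (k + s)` to `δ (k + 1 + s)`. -/
def gridIncr (W : ℝ → Ω → ℝ) (δ : ℝ) (k : ℕ) (s : ℝ) (ω : Ω) : ℝ :=
  W (δ * (k + 1 + s)) ω - W (δ * (k + s)) ω

namespace IsFBM

variable {P : Measure Ω} {H : ℝ} {W : ℝ → Ω → ℝ}

lemma measurable (hW : IsFBM P H W) (t : ℝ) : Measurable (W t) :=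
  hW.jointMeasurable.comp measurable_prodMk_left

lemma isCenteredGaussianFamily (hW : IsFBM P H W) {n : ℕ} {t : Fin n → ℝ} (ht : ∀ i, 0 ≤ t i) :
    IsCenteredGaussianFamily P (fun i => W (t i)) :=
  ⟨fun i => hW.measurable (t i), hW.gaussian_fdd n t ht⟩

lemma integrable_mul (hW : IsFBM P H W) {s t : ℝ} (hs : 0 ≤ s) (ht : 0 ≤ t) :
    Integrable (fun ω => W s ω * W t ω) P := by
  have := (hW.isCenteredGaussianFamily (t := ![s, t]) (by simp [Fin.forall_fin_two, hs, ht]))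
  simpa using this.integrable_mul 0 1

lemma isCenteredGaussianFamily_sub (hW : IsFBM P H W) {s t : Fin 4 → ℝ} (hs : ∀ i, 0 ≤ s i)
    (ht : ∀ i, 0 ≤ t i) :
    IsCenteredGaussianFamily P (fun i ω => W (s i) ω - W (t i) ω) := by
  refine ⟨fun i => (hW.measurable _).sub (hW.measurable _), fun c => ?_⟩
  obtain ⟨v, hv⟩ := hW.gaussian_fdd 8 (Fin.append s t)
    (fun i => by
      refine Fin.addCases (m := 4) (n := 4) (fun i => ?_) (fun i => ?_) i
      · rw [Fin.append_left]; exact hs i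
      · rw [Fin.append_right]; exact ht i)
    (Fin.append c (-c))
  refine ⟨v, ?_⟩
  rw [← hv]
  congr 1 with ω
  rw [Fin.sum_univ_add (a := 4) (b := 4)]
  simp only [Fin.append_left, Fin.append_right, Pi.neg_apply, ← Finset.sum_add_distrib]
  refine Finset.sum_congr rfl fun i _ => ?_
  ring

lemma integral_gridIncr_mul_gridIncr (hW : IsFBM P H W) {δ : ℝ} (hδ : 0 < δ) (k l : ℕ)
    {s t : ℝ} (hs : 0 ≤ s) (ht : 0 ≤ t) :
    ∫ ω, gridIncr W δ k s ω * gridIncr W δ l t ω ∂P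
      = δ ^ (2*H) * fgnCov H ((k + s) - (l + t)) := by
  have a1 : 0 ≤ δ * (k + 1 + s) := by positivity
  have a2 : 0 ≤ δ * (k + s) := by positivity
  have b1 : 0 ≤ δ * (l + 1 + t) := by positivity
  have b2 : 0 ≤ δ * (l + t) := by positivity
  have I1 := hW.integrable_mul a1 b1
  have I2 := hW.integrable_mul a1 b2
  have I3 := hW.integrable_mul a2 b1
  have I4 := hW.integrable_mul a2 b2
  have e : ∀ ω, gridIncr W δ k s ω * gridIncr W δ l t ω
      = W (δ * (k + 1 + s)) ω * W (δ * (l + 1 + t)) ω - W (δ * (k + 1 + s)) ω * W (δ * (l + t)) ω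
        - W (δ * (k + s)) ω * W (δ * (l + 1 + t)) ω + W (δ * (k + s)) ω * W (δ * (l + t)) ω := by
    intro ω; unfold gridIncr; ring
  simp_rw [e]
  rw [integral_add (by fun_prop) (by fun_prop), integral_sub (by fun_prop) (by fun_prop),
    integral_sub (by fun_prop) (by fun_prop), hW.cov _ _ a1 b1, hW.cov _ _ a1 b2,
    hW.cov _ _ a2 b1, hW.cov _ _ a2 b2]
  have m (y : ℝ) : |δ * y| ^ (2*H) = δ ^ (2*H) * |y| ^ (2*H) := by
    rw [abs_mul, abs_of_pos hδ, Real.mul_rpow hδ.le (abs_nonneg _)]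
  simp only [← mul_sub, m]
  unfold fgnCov
  rw [show (k:ℝ) + 1 + s - (l + 1 + t) = k + s - (l + t) by ring,
    show (k:ℝ) + 1 + s - (l + t) = k + s - (l + t) + 1 by ring,
    show (k:ℝ) + s - (l + 1 + t) = k + s - (l + t) - 1 by ring]
  ring

lemma isCenteredGaussianFamily_gridIncr (hW : IsFBM P H W) {δ : ℝ} (hδ : 0 < δ) (k : Fin 4 → ℕ)
    {s : Fin 4 → ℝ} (hs : ∀ i, 0 ≤ s i) :
    IsCenteredGaussianFamily P (fun i => gridIncr W δ (k i) (s i)) :=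
  hW.isCenteredGaussianFamily_sub (fun i => by have := hs i; positivity)
    (fun i => by have := hs i; positivity)

/-- The covariance of products of increments over the cells `k` and `l` of the grid. -/
lemma cov_gridIncr_products [IsProbabilityMeasure P] (hW : IsFBM P H W) {δ : ℝ} (hδ : 0 < δ)
    (k l : ℕ) {s t : ℝ} (hs : 0 ≤ s) (ht : 0 ≤ t) :
    Integrable (fun ω =>
      (gridIncr W δ k s ω * gridIncr W δ k t ω - δ ^ (2*H) * fgnCov H (s - t)) *
      (gridIncr W δ l s ω * gridIncr W δ l t ω - δ ^ (2*H) * fgnCov H (s - t))) P ∧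
    ∫ ω, (gridIncr W δ k s ω * gridIncr W δ k t ω - δ ^ (2*H) * fgnCov H (s - t)) *
      (gridIncr W δ l s ω * gridIncr W δ l t ω - δ ^ (2*H) * fgnCov H (s - t)) ∂P
      = (δ ^ (2*H)) ^ 2 *
        (fgnCov H ((k + s) - (l + s)) * fgnCov H ((k + t) - (l + t))
          + fgnCov H ((k + s) - (l + t)) * fgnCov H ((k + t) - (l + s))) := by
  have hX := hW.isCenteredGaussianFamily_gridIncr hδ ![k, k, l, l] (s := ![s, t, s, t])
    (by simp [Fin.forall_fin_succ, hs, ht])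
  have hwick := hX.integral_mul_mul_mul
  have I4 := hX.integrable_mul_mul_mul 0 1 2 3
  have I2 := hX.integrable_mul 0 1
  have I2' := hX.integrable_mul 2 3
  simp only [Matrix.cons_val] at hwick I4 I2 I2'
  rw [hW.integral_gridIncr_mul_gridIncr hδ k k hs ht, hW.integral_gridIncr_mul_gridIncr hδ l l hs ht,
    hW.integral_gridIncr_mul_gridIncr hδ k l hs hs, hW.integral_gridIncr_mul_gridIncr hδ k l ht ht,
    hW.integral_gridIncr_mul_gridIncr hδ k l hs ht,
    hW.integral_gridIncr_mul_gridIncr hδ k l ht hs] at hwick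
  have hk := hW.integral_gridIncr_mul_gridIncr hδ k k hs ht
  have hl := hW.integral_gridIncr_mul_gridIncr hδ l l hs ht
  rw [add_sub_add_left_eq_sub] at hk hl
  set c := δ ^ (2*H) * fgnCov H (s - t) with hc
  have e : ∀ ω, (gridIncr W δ k s ω * gridIncr W δ k t ω - c) *
      (gridIncr W δ l s ω * gridIncr W δ l t ω - c)
      = gridIncr W δ k s ω * gridIncr W δ k t ω * gridIncr W δ l s ω * gridIncr W δ l t ω
        - c * (gridIncr W δ k s ω * gridIncr W δ k t ω)
        - c * (gridIncr W δ l s ω * gridIncr W δ l t ω) + c * c := by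
    intro ω; ring
  simp_rw [e]
  refine ⟨by fun_prop, ?_⟩
  rw [integral_add (by fun_prop) (by fun_prop), integral_sub (by fun_prop) (by fun_prop),
    integral_sub (by fun_prop) (by fun_prop), integral_const_mul, integral_const_mul,
    hwick, hk, hl, add_sub_add_left_eq_sub, add_sub_add_left_eq_sub, ← hc]
  simp
  ring

end IsFBM

namespace IsFBM

variable {P : Measure Ω} {H : ℝ} {W : ℝ → Ω → ℝ}

lemma cov_gridIncr_products_le [IsProbabilityMeasure P] (hW : IsFBM P H W)
    (hH : H ∈ Set.Ioo (0:ℝ) 1) {δ : ℝ} (hδ : 0 < δ) (k l : ℕ) {s t : ℝ}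
    (hs : s ∈ Set.Icc (0:ℝ) 1) (ht : t ∈ Set.Icc (0:ℝ) 1) :
    ∫ ω, (gridIncr W δ k s ω * gridIncr W δ k t ω - δ ^ (2*H) * fgnCov H (s - t)) *
      (gridIncr W δ l s ω * gridIncr W δ l t ω - δ ^ (2*H) * fgnCov H (s - t)) ∂P
      ≤ (δ ^ (2*H)) ^ 2 * (2 * (288 ^ 2 * ((((k:ℤ) - l).natAbs : ℝ) + 1) ^ (4*H - 4))) := by
  rw [(hW.cov_gridIncr_products hδ k l hs.1 ht.1).2]
  set n := ((k:ℤ) - l).natAbs with hn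
  have hn' : (n:ℝ) = |(k:ℝ) - l| := by
    rw [hn, Nat.cast_natAbs]; push_cast; rfl
  have hb : ∀ x y : ℝ, x ∈ Set.Icc (0:ℝ) 1 → y ∈ Set.Icc (0:ℝ) 1 →
      |fgnCov H ((k + x) - (l + y))| ≤ 288 * ((n:ℝ) + 1) ^ (2*H - 2) := by
    rintro x y ⟨hx0, hx1⟩ ⟨hy0, hy1⟩
    have hxy : |x - y| ≤ 1 := by rw [abs_le]; constructor <;> linarith
    apply abs_fgnCov_le hH
    · have := abs_sub_abs_le_abs_sub ((k:ℝ) - l) (-(x - y))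
      rw [abs_neg, show (k:ℝ) - l - -(x - y) = k + x - (l + y) by ring] at this
      rw [hn']; linarith
    · have := abs_add_le ((k:ℝ) - l) (x - y)
      rw [show (k:ℝ) - l + (x - y) = k + x - (l + y) by ring] at this
      rw [hn']; linarith
  have hm : ∀ x y B : ℝ, |x| ≤ B → |y| ≤ B → x * y ≤ B ^ 2 := fun x y B hx hy =>
    calc x * y ≤ |x * y| := le_abs_self _
      _ = |x| * |y| := abs_mul x y
      _ ≤ B * B := mul_le_mul hx hy (abs_nonneg _) ((abs_nonneg _).trans hx)
      _ = B ^ 2 := (sq B).symm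
  have hsq : (288 * ((n:ℝ) + 1) ^ (2*H - 2)) ^ 2 = 288 ^ 2 * ((n:ℝ) + 1) ^ (4*H - 4) := by
    rw [mul_pow, ← Real.rpow_mul_natCast (by positivity)]
    congr 2
    push_cast
    ring
  rw [← hsq]
  have b1 := hm _ _ _ (hb s s hs hs) (hb t t ht ht)
  have b2 := hm _ _ _ (hb s t hs ht) (hb t s ht hs)
  gcongr
  linarith

lemma integral_sq_sum_gridIncr_le [IsProbabilityMeasure P] (hW : IsFBM P H W)
    (hH : H ∈ Set.Ioo (0:ℝ) 1) {δ : ℝ} (hδ : 0 < δ) {ε : ℝ} (h0 : 0 ≤ ε) (h1 : ε ≤ 1 / 2)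
    (hε : ε ≤ 4 - 4*H) (N : ℕ) {s t : ℝ}
    (hs : s ∈ Set.Icc (0:ℝ) 1) (ht : t ∈ Set.Icc (0:ℝ) 1) :
    ∫⁻ ω, ‖(1 / (N:ℝ)) * ∑ k ∈ Finset.range N,
      (gridIncr W δ k s ω * gridIncr W δ k t ω - δ ^ (2*H) * fgnCov H (s - t))‖ₑ ^ 2 ∂P
      ≤ ENNReal.ofReal ((δ ^ (2*H)) ^ 2 * (8 * 288 ^ 2) * (N:ℝ) ^ (-ε)) := by
  rcases Nat.eq_zero_or_pos N with rfl | hN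
  · simp
  have hN' : (0:ℝ) < N := by exact_mod_cast hN
  set Z : ℕ → Ω → ℝ := fun k ω =>
    gridIncr W δ k s ω * gridIncr W δ k t ω - δ ^ (2*H) * fgnCov H (s - t) with hZ
  have I (k l : ℕ) : Integrable (fun ω => Z k ω * Z l ω) P :=
    (hW.cov_gridIncr_products hδ k l hs.1 ht.1).1
  have e (ω : Ω) : ((1 / (N:ℝ)) * ∑ k ∈ Finset.range N, Z k ω) ^ 2
      = (1 / (N:ℝ)) ^ 2 * ∑ k ∈ Finset.range N, ∑ l ∈ Finset.range N, Z k ω * Z l ω := by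
    rw [mul_pow, sq (∑ k ∈ _, _), Finset.sum_mul_sum]
  have I' : Integrable (fun ω => ((1 / (N:ℝ)) * ∑ k ∈ Finset.range N, Z k ω) ^ 2) P := by
    simp_rw [e]
    fun_prop
  have hle : ∀ k ∈ Finset.range N, ∑ l ∈ Finset.range N, ∫ ω, Z k ω * Z l ω ∂P
      ≤ (δ ^ (2*H)) ^ 2 * (8 * 288 ^ 2) * (N:ℝ) ^ (1 - ε) := fun k hk => by
    calc ∑ l ∈ Finset.range N, ∫ ω, Z k ω * Z l ω ∂P
        ≤ ∑ l ∈ Finset.range N, (δ ^ (2*H)) ^ 2 *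
            (2 * (288 ^ 2 * ((((k:ℤ) - l).natAbs : ℝ) + 1) ^ (-ε))) := by
          refine Finset.sum_le_sum fun l _ => ?_
          refine (hW.cov_gridIncr_products_le hH hδ k l hs ht).trans ?_
          gcongr
          · linarith [Nat.cast_nonneg (α := ℝ) ((k:ℤ) - l).natAbs]
          · linarith
      _ = (δ ^ (2*H)) ^ 2 * (2 * 288 ^ 2) *
            ∑ l ∈ Finset.range N, ((((k:ℤ) - l).natAbs : ℝ) + 1) ^ (-ε) := by
          rw [Finset.mul_sum]
          refine Finset.sum_congr rfl fun l _ => ?_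
          ring
      _ ≤ (δ ^ (2*H)) ^ 2 * (2 * 288 ^ 2) * (2 * (2 * (N:ℝ) ^ (1 - ε))) := by
          gcongr
          refine (sum_range_natAbs_sub_le (f := fun n : ℕ => ((n:ℝ) + 1) ^ (-ε))
            (fun n => by positivity) (Finset.mem_range.1 hk)).trans ?_
          gcongr
          exact sum_range_rpow_neg_le h0 h1 N
      _ = (δ ^ (2*H)) ^ 2 * (8 * 288 ^ 2) * (N:ℝ) ^ (1 - ε) := by ring
  have hreal : ∫ ω, ((1 / (N:ℝ)) * ∑ k ∈ Finset.range N, Z k ω) ^ 2 ∂P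
      ≤ (δ ^ (2*H)) ^ 2 * (8 * 288 ^ 2) * (N:ℝ) ^ (-ε) := by
    simp_rw [e]
    rw [integral_const_mul, integral_finsetSum _ fun k _ => integrable_finsetSum _ fun l _ => I k l]
    simp_rw [integral_finsetSum _ fun l _ => I _ l]
    calc (1 / (N:ℝ)) ^ 2 * ∑ k ∈ Finset.range N, ∑ l ∈ Finset.range N, ∫ ω, Z k ω * Z l ω ∂P
        ≤ (1 / (N:ℝ)) ^ 2 * ∑ k ∈ Finset.range N,
            (δ ^ (2*H)) ^ 2 * (8 * 288 ^ 2) * (N:ℝ) ^ (1 - ε) := by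
          gcongr with k hk
          exact hle k hk
      _ = (δ ^ (2*H)) ^ 2 * (8 * 288 ^ 2) * (N:ℝ) ^ (-ε) := by
          rw [Finset.sum_const, Finset.card_range, nsmul_eq_mul,
            show -ε = (1 - ε) - 1 by ring, Real.rpow_sub_one hN'.ne']
          field_simp
  calc ∫⁻ ω, ‖(1 / (N:ℝ)) * ∑ k ∈ Finset.range N, Z k ω‖ₑ ^ 2 ∂P
      = ∫⁻ ω, ENNReal.ofReal (((1 / (N:ℝ)) * ∑ k ∈ Finset.range N, Z k ω) ^ 2) ∂P := by
        refine lintegral_congr fun ω => ?_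
        rw [← enorm_pow, Real.enorm_of_nonneg (sq_nonneg _)]
    _ = ENNReal.ofReal (∫ ω, ((1 / (N:ℝ)) * ∑ k ∈ Finset.range N, Z k ω) ^ 2 ∂P) :=
        (ofReal_integral_eq_lintegral_ofReal I' (ae_of_all _ fun _ => sq_nonneg _)).symm
    _ ≤ _ := ENNReal.ofReal_le_ofReal hreal

end IsFBM

lemma enorm_integral_sq_le {α : Type*} [MeasurableSpace α] {μ : Measure α}
    [IsProbabilityMeasure μ] {f : α → ℝ} (hf : AEStronglyMeasurable f μ) :
    ‖∫ x, f x ∂μ‖ₑ ^ 2 ≤ ∫⁻ x, ‖f x‖ₑ ^ 2 ∂μ := by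
  have h1 : ‖∫ x, f x ∂μ‖ₑ ≤ eLpNorm f 1 μ := by
    rw [eLpNorm_one_eq_lintegral_enorm]; exact enorm_integral_le_lintegral_enorm f
  have h2 : eLpNorm f 1 μ ≤ eLpNorm f 2 μ :=
    eLpNorm_le_eLpNorm_of_exponent_le (by norm_num) hf
  have h3 := eLpNorm_nnreal_pow_eq_lintegral (f := f) (μ := μ) (p := 2) (by norm_num)
  simp only [ENNReal.coe_ofNat, NNReal.coe_ofNat, ENNReal.rpow_ofNat] at h3
  rw [← h3]
  gcongr
  exact h1.trans h2

/-- Convergence in `L²` with summable rates implies almost sure convergence. -/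
lemma ae_tendsto_zero_of_tsum_lintegral_ne_top {P : Measure Ω} {Y : ℕ → Ω → ℝ}
    (hY : ∀ n, Measurable (Y n)) (h : ∑' n, ∫⁻ ω, ‖Y n ω‖ₑ ^ 2 ∂P ≠ ⊤) :
    ∀ᵐ ω ∂P, Tendsto (fun n => Y n ω) atTop (𝓝 0) := by
  rw [← lintegral_tsum fun n => by have := hY n; fun_prop] at h
  filter_upwards [ae_lt_top' (by fun_prop) h] with ω hω
  have h0 := ENNReal.tendsto_atTop_zero_of_tsum_ne_top hω.ne
  have h1 : Tendsto (fun n => ‖Y n ω‖ₑ) atTop (𝓝 0) := by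
    have := (ENNReal.continuous_rpow_const (y := (1/2 : ℝ))).tendsto 0 |>.comp h0
    simp only [Function.comp_def, ← ENNReal.rpow_natCast, ← ENNReal.rpow_mul] at this
    simpa using this
  rw [tendsto_zero_iff_norm_tendsto_zero]
  have := (ENNReal.tendsto_toReal ENNReal.zero_ne_top).comp h1
  simpa [Function.comp_def] using this

/-- Polynomially decaying second moments suffice for almost sure convergence of Cesàro means of
nonnegative random variables. -/
lemma ae_tendsto_average_of_lintegral_le {P : Measure Ω} {Y : ℕ → Ω → ℝ} {m K ε : ℝ}
    (hY : ∀ n, Measurable (Y n)) (hY0 : ∀ n ω, 0 ≤ Y n ω) (hε : 0 < ε)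
    (h : ∀ N : ℕ, 0 < N → ∫⁻ ω, ‖(1 / (N:ℝ)) * ∑ k ∈ Finset.range N, Y k ω - m‖ₑ ^ 2 ∂P
      ≤ ENNReal.ofReal (K * (N:ℝ) ^ (-ε))) :
    ∀ᵐ ω ∂P, Tendsto (fun N : ℕ => (1 / (N:ℝ)) * ∑ k ∈ Finset.range N, Y k ω) atTop (𝓝 m) := by
  obtain ⟨p, hp⟩ := exists_nat_gt (2 / ε)
  have hpε : 2 < p * ε := by rwa [div_lt_iff₀ hε] at hp
  have hp0 : p ≠ 0 := by rintro rfl; norm_num at hpε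
  have hsum : ∑' n : ℕ, ∫⁻ ω, ‖(1 / (((n + 1) ^ p : ℕ):ℝ)) *
      ∑ k ∈ Finset.range ((n + 1) ^ p), Y k ω - m‖ₑ ^ 2 ∂P ≠ ⊤ := by
    refine ne_top_of_le_ne_top ?_ (ENNReal.tsum_le_tsum fun n => h ((n + 1) ^ p) (by positivity))
    have hs : Summable fun n : ℕ => K * ((((n + 1) ^ p : ℕ):ℝ)) ^ (-ε) := by
      refine Summable.mul_left K ?_
      have : ∀ n : ℕ, ((((n + 1) ^ p : ℕ):ℝ)) ^ (-ε) = ((n + 1 : ℕ):ℝ) ^ (-(p * ε)) := fun n => by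
        rw [Nat.cast_pow, ← Real.rpow_natCast_mul (Nat.cast_nonneg _)]; congr 1; ring
      simp_rw [this]
      exact (summable_nat_add_iff 1).2 (Real.summable_nat_rpow.2 (by linarith))
    exact hs.tsum_ofReal_ne_top
  have hlim := ae_tendsto_zero_of_tsum_lintegral_ne_top (P := P)
    (Y := fun n ω => (1 / (((n + 1) ^ p : ℕ):ℝ)) * ∑ k ∈ Finset.range ((n + 1) ^ p), Y k ω - m)
    (fun n => by fun_prop) hsum
  filter_upwards [hlim] with ω hω
  have := tendsto_div_of_monotone_of_exists_subseq_tendsto_div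
    (fun N => ∑ k ∈ Finset.range N, Y k ω) m
    (fun a b hab => Finset.sum_le_sum_of_subset_of_nonneg (Finset.range_subset_range.2 hab)
      fun _ _ _ => hY0 _ _) fun a ha => ⟨fun n => (n + 1) ^ p, ?_,
      (tendsto_pow_atTop hp0).comp (tendsto_add_atTop_nat 1), ?_⟩
  · simpa only [div_eq_inv_mul, one_div, mul_one] using this
  · have hr : Tendsto (fun n : ℕ => (1 + 1 / ((n:ℝ) + 1)) ^ p) atTop (𝓝 1) := by
      simpa using (tendsto_one_div_add_atTop_nhds_zero_nat (𝕜 := ℝ)).const_add 1 |>.pow p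
    filter_upwards [hr.eventually_le_const ha] with n hn
    calc (((n + 1 + 1) ^ p : ℕ) : ℝ) = (1 + 1 / ((n:ℝ) + 1)) ^ p * ((n:ℝ) + 1) ^ p := by
          rw [← mul_pow]; push_cast; congr 1; field_simp
      _ ≤ a * (((n + 1) ^ p : ℕ) : ℝ) := by push_cast; gcongr
  · have := hω.add_const m
    simpa only [sub_add_cancel, zero_add, div_eq_inv_mul, one_div, mul_one] using this

lemma hasDerivAt_mul_abs_rpow {p : ℝ} (hp : 0 < p) (x : ℝ) :
    HasDerivAt (fun y : ℝ => y * |y| ^ p) ((p + 1) * |x| ^ p) x := by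
  have hc : Continuous fun y : ℝ => |y| ^ p :=
    continuous_abs.rpow_const fun _ => Or.inr hp.le
  have hne : ∀ y : ℝ, y ≠ 0 → HasDerivAt (fun y : ℝ => y * |y| ^ p) ((p + 1) * |y| ^ p) y := by
    intro y hy
    have hd := (hasDerivAt_id y).mul
      ((hasDerivAt_abs hy).rpow_const (p := p) (Or.inl (abs_ne_zero.2 hy)))
    refine hd.congr_deriv ?_
    have hs : y * (SignType.sign y : ℝ) = |y| := by rw [mul_comm, sign_mul_self]
    have hp' : |y| * |y| ^ (p - 1) = |y| ^ p := by
      rw [Real.rpow_sub_one (abs_ne_zero.2 hy), mul_div_cancel₀ _ (abs_ne_zero.2 hy)]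
    simp only [id, one_mul]
    linear_combination (p * |y| ^ (p - 1)) * hs + p * hp'
  rcases eq_or_ne x 0 with rfl | hx
  · exact hasDerivAt_of_hasDerivAt_of_ne (g := fun y => (p + 1) * |y| ^ p) hne
      (continuous_id.mul hc).continuousAt (hc.const_mul _).continuousAt
  · exact hne x hx

lemma integral_integral_abs_sub_add_rpow {p : ℝ} (hp : 0 < p) (m : ℝ) :
    ∫ s in (0:ℝ)..1, ∫ t in (0:ℝ)..1, |s - t + m| ^ p
      = (|m + 1| ^ (p + 2) - 2 * |m| ^ (p + 2) + |m - 1| ^ (p + 2)) / ((p + 1) * (p + 2)) := by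
  have hc : Continuous fun y : ℝ => |y| ^ p :=
    continuous_abs.rpow_const fun _ => Or.inr hp.le
  have h1 : 0 < p + 1 := by linarith
  have h2 : 0 < p + 2 := by linarith
  have hQ (x : ℝ) : HasDerivAt (fun y : ℝ => y * |y| ^ p / (p + 1)) (|x| ^ p) x :=
    ((hasDerivAt_mul_abs_rpow hp x).div_const (p + 1)).congr_deriv (by field_simp)
  have hR (x : ℝ) : HasDerivAt (fun y : ℝ => |y| ^ (p + 2) / ((p + 1) * (p + 2)))
      (x * |x| ^ p / (p + 1)) x :=
    ((hasDerivAt_abs_rpow x (by linarith : 1 < p + 2)).div_const _).congr_deriv (by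
      rw [add_sub_cancel_right]; field_simp)
  have hinner (s : ℝ) : ∫ t in (0:ℝ)..1, |s - t + m| ^ p
      = (s + m) * |s + m| ^ p / (p + 1) - (s + (m - 1)) * |s + (m - 1)| ^ p / (p + 1) := by
    have := intervalIntegral.integral_eq_sub_of_hasDerivAt (a := 0) (b := 1)
      (f := fun t : ℝ => -((s + m - t) * |s + m - t| ^ p / (p + 1)))
      (f' := fun t => |s - t + m| ^ p)
      (fun t _ => by
        have := (HasDerivAt.comp_const_sub (s + m) t (hQ (s + m - t))).neg
        rw [neg_neg, show s + m - t = s - t + m by ring] at this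
        exact this)
      ((hc.comp (by fun_prop : Continuous fun t : ℝ => s - t + m)).intervalIntegrable _ _)
    rw [this, show s + m - 1 = s + (m - 1) by ring, sub_zero]
    ring
  simp_rw [hinner]
  have hcQ (c : ℝ) : Continuous fun s : ℝ => (s + c) * |s + c| ^ p / (p + 1) := by
    have : Continuous fun s : ℝ => |s + c| ^ p := hc.comp (continuous_add_const c)
    fun_prop
  have houter (c : ℝ) : ∫ s in (0:ℝ)..1, (s + c) * |s + c| ^ p / (p + 1)
      = |1 + c| ^ (p + 2) / ((p + 1) * (p + 2)) - |0 + c| ^ (p + 2) / ((p + 1) * (p + 2)) :=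
    intervalIntegral.integral_eq_sub_of_hasDerivAt
      (f := fun s : ℝ => |s + c| ^ (p + 2) / ((p + 1) * (p + 2)))
      (fun s _ => HasDerivAt.comp_add_const s c (hR (s + c)))
      ((hcQ c).intervalIntegrable _ _)
  rw [intervalIntegral.integral_sub ((hcQ m).intervalIntegrable _ _)
    ((hcQ (m - 1)).intervalIntegrable _ _), houter, houter,
    show 1 + (m - 1) = m by ring, zero_add, zero_add, add_comm 1 m]
  ring

/-- The uniform distribution on the unit interval. -/
def unitUniform : Measure ℝ := volume.restrict (Set.Ioc 0 1)

instance : IsProbabilityMeasure unitUniform := ⟨by simp [unitUniform]⟩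

lemma integral_unitUniform (f : ℝ → ℝ) : ∫ s, f s ∂unitUniform = ∫ s in (0:ℝ)..1, f s :=
  (intervalIntegral.integral_of_le zero_le_one).symm

lemma integrable_unitUniform_prod {f : ℝ × ℝ → ℝ} (hf : Continuous f) :
    Integrable f (unitUniform.prod unitUniform) := by
  rw [unitUniform, Measure.prod_restrict]
  exact (hf.continuousOn.integrableOn_compact (isCompact_Icc.prod isCompact_Icc)).mono_set
    (Set.prod_mono Set.Ioc_subset_Icc_self Set.Ioc_subset_Icc_self)

lemma ae_mem_unitUniform_prod :
    ∀ᵐ x ∂(unitUniform.prod unitUniform), x.1 ∈ Set.Icc (0:ℝ) 1 ∧ x.2 ∈ Set.Icc (0:ℝ) 1 := by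
  rw [unitUniform, Measure.prod_restrict]
  filter_upwards [ae_restrict_mem (measurableSet_Ioc.prod measurableSet_Ioc)] with x hx
  exact ⟨Set.Ioc_subset_Icc_self hx.1, Set.Ioc_subset_Icc_self hx.2⟩

lemma integral_fgnCov_sub {H : ℝ} (hH : 0 < H) :
    ∫ x, fgnCov H (x.1 - x.2) ∂(unitUniform.prod unitUniform)
      = 2 * ((2:ℝ) ^ (2*H) - 1) / ((2*H + 1) * (H + 1)) := by
  have hp : 0 < 2 * H := by linarith
  have hc (m : ℝ) : Continuous fun x : ℝ × ℝ => |x.1 - x.2 + m| ^ (2*H) :=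
    (by fun_prop : Continuous fun x : ℝ × ℝ => |x.1 - x.2 + m|).rpow_const
      fun _ => Or.inr hp.le
  have I (m : ℝ) := integrable_unitUniform_prod (hc m)
  have hval (m : ℝ) : ∫ x : ℝ × ℝ, |x.1 - x.2 + m| ^ (2*H) ∂(unitUniform.prod unitUniform)
      = (|m + 1| ^ (2*H + 2) - 2 * |m| ^ (2*H + 2) + |m - 1| ^ (2*H + 2))
        / ((2*H + 1) * (2*H + 2)) := by
    rw [integral_prod _ (I m), integral_unitUniform]
    simp_rw [integral_unitUniform]
    exact integral_integral_abs_sub_add_rpow hp m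
  have e : ∀ x : ℝ × ℝ, fgnCov H (x.1 - x.2)
      = (1 / 2) * (|x.1 - x.2 + 1| ^ (2*H) + |x.1 - x.2 + -1| ^ (2*H)
        - 2 * |x.1 - x.2 + 0| ^ (2*H)) := fun x => by
    unfold fgnCov
    rw [add_zero, ← sub_eq_add_neg]
    ring
  have I1 := I 1
  have I2 := I (-1)
  have I3 := I 0
  simp_rw [e]
  rw [integral_const_mul, integral_sub (by fun_prop) (by fun_prop),
    integral_add (by fun_prop) (by fun_prop), integral_const_mul, hval, hval, hval]
  have h4 : (2:ℝ) ^ (2*H + 2) = 4 * (2:ℝ) ^ (2*H) := by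
    rw [Real.rpow_add (by norm_num)]; norm_num; ring
  norm_num [Real.zero_rpow (by linarith : 2*H + 2 ≠ 0), h4]
  field_simp
  ring

lemma nifBm_sub_nifBm {E : Type*} {W : ℝ → E → ℝ} {δ : ℝ} (hδ : 0 < δ) (k : ℕ) {ω : E}
    (hω : Continuous fun t => W t ω) :
    nifBm W δ (((k:ℝ) + 1) * δ) ω - nifBm W δ ((k:ℝ) * δ) ω
      = ∫ s, gridIncr W δ k s ω ∂unitUniform := by
  have h (c : ℝ) : nifBm W δ (c * δ) ω = ∫ s in (0:ℝ)..1, W (δ * (c + s)) ω := by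
    have := intervalIntegral.integral_comp_mul_add (a := 0) (b := 1) (fun u => W u ω) hδ.ne' (c * δ)
    unfold nifBm
    rw [mul_zero, zero_add, mul_one, add_comm δ] at this
    rw [one_div, ← smul_eq_mul, ← this]
    congr 1 with s
    congr 1
    ring
  have hi (c : ℝ) : IntervalIntegrable (fun s => W (δ * (c + s)) ω) volume 0 1 :=
    (hω.comp (by fun_prop : Continuous fun s : ℝ => δ * (c + s))).intervalIntegrable _ _
  rw [integral_unitUniform, h, h, ← intervalIntegral.integral_sub (hi _) (hi _)]
  rfl

namespace IsFBM

variable {P : Measure Ω} {H : ℝ} {W : ℝ → Ω → ℝ}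

lemma measurable_nifBm (hW : IsFBM P H W) {δ : ℝ} (hδ : 0 < δ) (t : ℝ) :
    Measurable (nifBm W δ t) := by
  unfold nifBm
  simp_rw [intervalIntegral.integral_of_le (by linarith : t ≤ t + δ)]
  exact (hW.jointMeasurable.stronglyMeasurable.integral_prod_left
    (μ := volume.restrict (Set.Ioc t (t + δ)))).measurable.const_mul _

lemma measurable_uncurry_gridIncr (hW : IsFBM P H W) (δ : ℝ) (k : ℕ) {β : Type*}
    [MeasurableSpace β] {f : β → ℝ} {g : β → Ω} (hf : Measurable f) (hg : Measurable g) :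
    Measurable fun b => gridIncr W δ k (f b) (g b) := by
  have := hW.jointMeasurable
  have h (u : β → ℝ) (hu : Measurable u) : Measurable fun b => W (u b) (g b) :=
    this.comp (hu.prodMk hg)
  exact (h _ (by fun_prop)).sub (h _ (by fun_prop))

/-- Strong law of large numbers for the squared increments of the integrated process. -/
lemma ae_tendsto_average_nifBm_sub_sq [IsProbabilityMeasure P] (hW : IsFBM P H W)
    (hH : H ∈ Set.Ioo (0:ℝ) 1) {δ : ℝ} (hδ : 0 < δ) :
    ∀ᵐ ω ∂P, Tendsto (fun N : ℕ => (1 / (N:ℝ)) * ∑ k ∈ Finset.range N,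
      (nifBm W δ (((k:ℝ) + 1) * δ) ω - nifBm W δ ((k:ℝ) * δ) ω) ^ 2) atTop
      (𝓝 (δ ^ (2*H) * (2 * ((2:ℝ) ^ (2*H) - 1) / ((2*H + 1) * (H + 1))))) := by
  have hH0 := hH.1
  have hH1 := hH.2
  set ε : ℝ := min (1 / 2) (4 - 4*H) with hε
  have hε0 : 0 < ε := lt_min (by norm_num) (by linarith)
  refine ae_tendsto_average_of_lintegral_le (K := (δ ^ (2*H)) ^ 2 * (8 * 288 ^ 2)) (ε := ε)
    (fun k => ((hW.measurable_nifBm hδ _).sub (hW.measurable_nifBm hδ _)).pow_const 2)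
    (fun _ _ => sq_nonneg _) hε0 fun N hN => ?_
  have hN' : (0:ℝ) < N := by exact_mod_cast hN
  set Z : ℝ × ℝ → Ω → ℝ := fun x ω => (1 / (N:ℝ)) * ∑ k ∈ Finset.range N,
    (gridIncr W δ k x.1 ω * gridIncr W δ k x.2 ω - δ ^ (2*H) * fgnCov H (x.1 - x.2)) with hZ
  have hcf := continuous_fgnCov hH0
  have hZm : Measurable (Function.uncurry fun ω x => Z x ω) := by
    have := fun k => hW.measurable_uncurry_gridIncr (β := Ω × (ℝ × ℝ)) δ k
      (f := fun b => b.2.1) (g := Prod.fst) (by fun_prop) measurable_fst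
    have := fun k => hW.measurable_uncurry_gridIncr (β := Ω × (ℝ × ℝ)) δ k
      (f := fun b => b.2.2) (g := Prod.fst) (by fun_prop) measurable_fst
    have := hcf.measurable
    simp only [hZ, Function.uncurry_def]
    fun_prop
  have hrepr : ∀ᵐ ω ∂P, (1 / (N:ℝ)) * ∑ k ∈ Finset.range N,
      (nifBm W δ (((k:ℝ) + 1) * δ) ω - nifBm W δ ((k:ℝ) * δ) ω) ^ 2
      - δ ^ (2*H) * (2 * ((2:ℝ) ^ (2*H) - 1) / ((2*H + 1) * (H + 1)))
      = ∫ x, Z x ω ∂(unitUniform.prod unitUniform) := by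
    filter_upwards [hW.cont] with ω hω
    have hG (k : ℕ) : Continuous fun s => gridIncr W δ k s ω :=
      (hω.comp (by fun_prop : Continuous fun s : ℝ => δ * (k + 1 + s))).sub
        (hω.comp (by fun_prop : Continuous fun s : ℝ => δ * (k + s)))
    have I1 (k : ℕ) : Integrable (fun x : ℝ × ℝ => gridIncr W δ k x.1 ω * gridIncr W δ k x.2 ω)
        (unitUniform.prod unitUniform) :=
      integrable_unitUniform_prod
        (((hG k).comp continuous_fst).mul ((hG k).comp continuous_snd))
    have I2 : Integrable (fun x : ℝ × ℝ => δ ^ (2*H) * fgnCov H (x.1 - x.2))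
        (unitUniform.prod unitUniform) :=
      integrable_unitUniform_prod (by fun_prop)
    have I12 (k : ℕ) : Integrable (fun x : ℝ × ℝ => gridIncr W δ k x.1 ω * gridIncr W δ k x.2 ω
        - δ ^ (2*H) * fgnCov H (x.1 - x.2)) (unitUniform.prod unitUniform) := (I1 k).sub I2
    simp only [hZ]
    rw [integral_const_mul, integral_finsetSum _ fun k _ => I12 k]
    have hk (k : ℕ) : ∫ x : ℝ × ℝ, (gridIncr W δ k x.1 ω * gridIncr W δ k x.2 ω
        - δ ^ (2*H) * fgnCov H (x.1 - x.2)) ∂(unitUniform.prod unitUniform)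
        = (nifBm W δ (((k:ℝ) + 1) * δ) ω - nifBm W δ ((k:ℝ) * δ) ω) ^ 2
          - δ ^ (2*H) * (2 * ((2:ℝ) ^ (2*H) - 1) / ((2*H + 1) * (H + 1))) := by
      rw [integral_sub (I1 k) I2, integral_const_mul, integral_fgnCov_sub hH0,
        nifBm_sub_nifBm hδ k hω, sq]
      congr 1
      exact integral_prod_mul (fun s => gridIncr W δ k s ω) (fun s => gridIncr W δ k s ω)
    simp_rw [hk]
    rw [Finset.sum_sub_distrib, Finset.sum_const, Finset.card_range, nsmul_eq_mul,
      mul_sub (1 / (N:ℝ)), one_div, inv_mul_cancel_left₀ hN'.ne']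
  calc _ = ∫⁻ ω, ‖∫ x, Z x ω ∂(unitUniform.prod unitUniform)‖ₑ ^ 2 ∂P := by
        refine lintegral_congr_ae ?_
        filter_upwards [hrepr] with ω hω
        rw [hω]
    _ ≤ ∫⁻ ω, ∫⁻ x, ‖Z x ω‖ₑ ^ 2 ∂(unitUniform.prod unitUniform) ∂P :=
        lintegral_mono fun ω => enorm_integral_sq_le
          (hZm.comp measurable_prodMk_left).aestronglyMeasurable
    _ = ∫⁻ x, ∫⁻ ω, ‖Z x ω‖ₑ ^ 2 ∂P ∂(unitUniform.prod unitUniform) :=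
        lintegral_lintegral_swap (hZm.enorm.pow_const 2).aemeasurable
    _ ≤ ∫⁻ x, ENNReal.ofReal ((δ ^ (2*H)) ^ 2 * (8 * 288 ^ 2) * (N:ℝ) ^ (-ε))
          ∂(unitUniform.prod unitUniform) := by
        refine lintegral_mono_ae ?_
        filter_upwards [ae_mem_unitUniform_prod] with x hx
        exact hW.integral_sq_sum_gridIncr_le hH hδ hε0.le (min_le_left _ _) (min_le_right _ _)
          N hx.1 hx.2
    _ = _ := by simp

end IsFBM

/-- The limit of the second-order statistic at scale `j h`. -/
lemma IsFBM.ae_tendsto_xiOne {P : Measure Ω} [IsProbabilityMeasure P] {H : ℝ} {W : ℝ → Ω → ℝ}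
    (hW : IsFBM P H W) (hH : H ∈ Set.Ioo (0:ℝ) 1) (a : ℝ) {h : ℝ} (hh : 0 < h) {j : ℕ}
    (hj : 0 < j) :
    ∀ᵐ ω ∂P, Tendsto (fun N : ℕ => xiOne W a h j N ω) atTop
      (𝓝 (a ^ 2 * ((j * h) ^ (2*H) * (2 * ((2:ℝ) ^ (2*H) - 1) / ((2*H + 1) * (H + 1)))))) := by
  have hj' : (0:ℝ) < j := by exact_mod_cast hj
  filter_upwards [hW.ae_tendsto_average_nifBm_sub_sq hH (mul_pos hj' hh)] with ω hω
  refine (hω.const_mul (a ^ 2)).congr fun N => ?_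
  unfold xiOne
  rw [mul_left_comm, Finset.mul_sum]
  congr 1
  refine Finset.sum_congr rfl fun k _ => ?_
  ring

/-- Strong consistency of `θ̂_N = (Ĥ_N, â²_N)` in the one-nifBm model:
for `0 < H < 1` and `a² > 0`, `(Ĥ_N, â²_N) → (H, a²)` almost surely. -/
theorem full_estimator_one_nifBm_strongly_consistent
    (P : Measure Ω) [IsProbabilityMeasure P]
    (H : ℝ) (hH : H ∈ Set.Ioo (0:ℝ) 1)
    (W : ℝ → Ω → ℝ) (hW : IsFBM P H W)
    (a : ℝ) (ha : 0 < a^2) (h : ℝ) (hh : 0 < h) :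
    ∀ᵐ ω ∂P,
      Tendsto (fun N : ℕ => HestOne W a h N ω) atTop (𝓝 H) ∧
      Tendsto (fun N : ℕ => a2estOne W a h N ω) atTop (𝓝 (a^2)) := by
  have hH0 := hH.1
  filter_upwards [hW.ae_tendsto_xiOne hH a hh one_pos, hW.ae_tendsto_xiOne hH a hh two_pos]
    with ω hξ1 hξ2
  have h2 : (1:ℝ) < 2 ^ (2*H) := Real.one_lt_rpow one_lt_two (by linarith)
  have hK : 0 < 2 * ((2:ℝ) ^ (2*H) - 1) / ((2*H + 1) * (H + 1)) := by
    have : 0 < (2:ℝ) ^ (2*H) - 1 := by linarith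
    positivity
  have hhH : 0 < h ^ (2*H) := Real.rpow_pos_of_pos hh _
  have hlog2 : 0 < Real.log 2 := Real.log_pos one_lt_two
  rw [Nat.cast_one, one_mul] at hξ1
  rw [Nat.cast_ofNat, Real.mul_rpow zero_le_two hh.le] at hξ2
  have hratio : Tendsto (fun N : ℕ => xiOne W a h 2 N ω / xiOne W a h 1 N ω) atTop
      (𝓝 ((2:ℝ) ^ (2*H))) := by
    have := hξ2.div hξ1 (by positivity)
    rwa [mul_assoc (2 ^ (2*H)), mul_left_comm (a ^ 2), mul_div_cancel_right₀ _ (by positivity)]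
      at this
  have hlogpos : Tendsto (fun N : ℕ => logpos (xiOne W a h 2 N ω / xiOne W a h 1 N ω)) atTop
      (𝓝 (Real.log ((2:ℝ) ^ (2*H)))) := by
    refine (hratio.log (by positivity)).congr' ?_
    filter_upwards [hratio.eventually_const_lt (by positivity : (0:ℝ) < 2 ^ (2*H))] with N hN
    rw [logpos, if_pos hN]
  have hHest : Tendsto (fun N : ℕ => HestOne W a h N ω) atTop (𝓝 H) := by
    have := hlogpos.const_mul (1 / (2 * Real.log 2))
    rw [Real.log_rpow two_pos] at this
    rwa [show 1 / (2 * Real.log 2) * (2 * H * Real.log 2) = H by field_simp] at this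
  refine ⟨hHest, ?_⟩
  have h2H := hHest.const_mul 2
  have hAest : Tendsto (fun N : ℕ => AestOne W a h N ω) atTop
      (𝓝 (2 * h ^ (2*H) / ((2*H + 1) * (H + 1)))) :=
    ((tendsto_const_nhds.rpow h2H (Or.inl hh.ne')).const_mul 2).div
      ((h2H.add_const 1).mul (hHest.add_const 1)) (by positivity)
  have hpow : Tendsto (fun N : ℕ => (2:ℝ) ^ (2 * HestOne W a h N ω) - 1) atTop
      (𝓝 ((2:ℝ) ^ (2*H) - 1)) := (tendsto_const_nhds.rpow h2H (Or.inl two_ne_zero)).sub_const 1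
  have hne : (2:ℝ) ^ (2*H) - 1 ≠ 0 := by linarith
  have hlim := hξ1.div (hAest.mul hpow) (by positivity)
  rwa [show a ^ 2 * (h ^ (2*H) * (2 * ((2:ℝ) ^ (2*H) - 1) / ((2*H + 1) * (H + 1))))
      / (2 * h ^ (2*H) / ((2*H + 1) * (H + 1)) * ((2:ℝ) ^ (2*H) - 1)) = a ^ 2 by
    field_simp] at hlim
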